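/- Let G be a finite simple graph that is cubic (every vertex has degree 3) and let c be a proper 3-edge-colouring of G with three colours. Let S be any set of vertices of G and let T be the edge cut determined by S (the set of edges of G with exactly one endpoint in S). Then for every colour k, the number of edges of T receiving colour k is congruent modulo 2 to the total number of edges of T. (Parity Lemma of Blanuša and Descartes.) -/

import Mathlib

/-- A proper edge colouring of a graph: two distinct edges sharing an endpoint
receive different colours. -/
def ProperEdgeColouring {V : Type*} {α : Type*} (G : SimpleGraph V) (c : Sym2 V → α) : Prop :=
  ∀ e₁ ∈ G.edgeSet, ∀ e₂ ∈ G.edgeSet, e₁ ≠ e₂ → (∃ v, v ∈ e₁ ∧ v ∈ e₂) → c e₁ ≠ c e₂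

/-- A cubic graph: every vertex has degree 3. -/
def IsCubic {V : Type*} (G : SimpleGraph V) : Prop :=
  ∀ v : V, (G.neighborSet v).ncard = 3

/-- The edge cut determined by a vertex set `S`: the set of edges of `G`
with exactly one endpoint in `S`. -/
def edgeCut {V : Type*} (G : SimpleGraph V) (S : Set V) : Set (Sym2 V) :=
  {e | ∃ u v, e = s(u, v) ∧ G.Adj u v ∧ u ∈ S ∧ v ∉ S}

/-- The spanning subgraph formed by the edges of colour `k`. -/
def colourClass {V α : Type*} (G : SimpleGraph V) (c : Sym2 V → α) (k : α) : SimpleGraph V where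
  Adj u v := G.Adj u v ∧ c s(u, v) = k
  symm := ⟨fun u v h => ⟨h.1.symm, by rw [Sym2.eq_swap]; exact h.2⟩⟩
  loopless := ⟨fun u h => G.loopless.irrefl u h.1⟩

theorem edgeCut_colourClass {V α : Type*} (G : SimpleGraph V) (c : Sym2 V → α) (k : α)
    (S : Set V) : edgeCut (colourClass G c k) S = edgeCut G S ∩ {e | c e = k} := by
  ext e
  constructor
  · rintro ⟨u, v, rfl, h, hu, hv⟩
    exact ⟨⟨u, v, rfl, h.1, hu, hv⟩, h.2⟩
  · rintro ⟨⟨u, v, rfl, h, hu, hv⟩, hk⟩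
    exact ⟨u, v, rfl, ⟨h, hk⟩, hu, hv⟩

theorem ncard_neighborSet_colourClass {V : Type*} {G : SimpleGraph V} {c : Sym2 V → Fin 3}
    (hcubic : IsCubic G) (hproper : ProperEdgeColouring G c) (k : Fin 3) (v : V) :
    ((colourClass G c k).neighborSet v).ncard = 1 := by
  have hinj : Set.InjOn (fun w => c s(v, w)) (G.neighborSet v) := by
    intro a ha b hb hab
    by_contra hne
    exact hproper s(v, a) ha s(v, b) hb (mt Sym2.congr_right.mp hne) ⟨v, by simp, by simp⟩ hab
  have himage : (fun w => c s(v, w)) '' G.neighborSet v = Set.univ := by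
    apply Set.eq_of_subset_of_ncard_le (Set.subset_univ _)
    rw [hinj.ncard_image, hcubic v, Set.ncard_univ, Nat.card_fin]
  obtain ⟨w, hw, hwk⟩ : k ∈ (fun w => c s(v, w)) '' G.neighborSet v := himage ▸ Set.mem_univ k
  refine Set.ncard_eq_one.mpr ⟨w, Set.eq_singleton_iff_unique_mem.mpr ⟨⟨hw, hwk⟩, ?_⟩⟩
  exact fun x hx => hinj hx.1 hw (hx.2.trans hwk.symm)

open Finset in
/-- If every degree is odd, an edge cut has the parity of the vertex set determining it. -/
theorem ncard_edgeCut_modEq_of_odd {V : Type*} [Fintype V] (H : SimpleGraph V)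
    (hodd : ∀ v, Odd (H.neighborSet v).ncard) (S : Set V) :
    (edgeCut H S).ncard ≡ S.ncard [MOD 2] := by
  classical
  have hcut : (edgeCut H S).ncard = ∑ u with u ∈ S, #{v | H.Adj u v ∧ v ∉ S} := by
    have himage : edgeCut H S = (fun p : (_ : V) × V => s(p.1, p.2)) ''
        (({u | u ∈ S} : Finset V).sigma fun u => {v | H.Adj u v ∧ v ∉ S}) := by
      ext e
      constructor
      · rintro ⟨u, v, rfl, h, hu, hv⟩
        exact ⟨⟨u, v⟩, by simp [h, hu, hv], rfl⟩
      · rintro ⟨⟨u, v⟩, h, rfl⟩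
        simp only [coe_sigma, Set.mem_sigma_iff, coe_filter, mem_univ, true_and,
          Set.mem_ofPred_eq] at h
        exact ⟨u, v, rfl, h.2.1, h.1, h.2.2⟩
    rw [himage, Set.InjOn.ncard_image, Set.ncard_coe_finset, card_sigma]
    rintro ⟨a, b⟩ hab ⟨a', b'⟩ hab' h
    simp only [coe_sigma, Set.mem_sigma_iff, coe_filter, mem_univ, true_and,
      Set.mem_ofPred_eq] at hab hab'
    rcases Sym2.eq_iff.mp h with ⟨rfl, rfl⟩ | ⟨rfl, rfl⟩
    · rfl
    · exact absurd hab.1 hab'.2.2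
  have hinner : ((∑ u with u ∈ S, #{v | H.Adj u v ∧ v ∈ S} : ℕ) : ZMod 2) = 0 := by
    rw [← card_sigma, card_eq_sum_ones, Nat.cast_sum]
    refine sum_involution (fun p _ => ⟨p.2, p.1⟩) (fun _ _ => by decide) ?_ ?_ (fun _ _ => rfl)
    · rintro ⟨u, v⟩ h _ heq
      simp only [mem_sigma, mem_filter, mem_univ, true_and] at h
      exact h.2.1.ne (Sigma.mk.inj heq).1.symm
    · rintro ⟨u, v⟩ h
      simp only [mem_sigma, mem_filter, mem_univ, true_and] at h ⊢
      exact ⟨h.2.2, h.2.1.symm, h.1⟩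
  have hdegree (u : V) : ((#{v | H.Adj u v ∧ v ∈ S} : ℕ) : ZMod 2)
      + (#{v | H.Adj u v ∧ v ∉ S} : ℕ) = 1 := by
    rw [← Nat.cast_add, ← filter_filter, ← filter_filter, card_filter_add_card_filter_not,
      ← ZMod.natCast_eq_one_iff_odd.mpr (hodd u), ← Set.ncard_coe_finset]
    congr 2
    ext v
    simp
  rw [← ZMod.natCast_eq_natCast_iff, hcut, ← zero_add (Nat.cast _), ← hinner, Nat.cast_sum,
    Nat.cast_sum, ← sum_add_distrib, sum_congr rfl fun u _ => hdegree u, sum_const, nsmul_one,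
    ← Set.ncard_coe_finset]
  simp

/-- **Parity Lemma** (Blanuša, Descartes): in a cubic graph with a proper
3-edge-colouring, for any edge cut `T` and any colour `k`, the number of edges
of `T` with colour `k` is congruent to `|T|` modulo 2. -/
theorem parity_lemma {V : Type*} [Fintype V] (G : SimpleGraph V) (c : Sym2 V → Fin 3)
    (hcubic : IsCubic G) (hproper : ProperEdgeColouring G c)
    (S : Set V) (k : Fin 3) :
    (edgeCut G S ∩ {e | c e = k}).ncard ≡ (edgeCut G S).ncard [MOD 2] := by
  rw [← edgeCut_colourClass]
  refine (ncard_edgeCut_modEq_of_odd _ (fun v => ?_) S).trans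
    (ncard_edgeCut_modEq_of_odd G (fun v => ?_) S).symm
  · simp [ncard_neighborSet_colourClass hcubic hproper k v]
  · rw [hcubic v]
    decide
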